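/- Let 1 < p < 5 and ω = ω_c = √(p−1)/2 (or ω = −ω_c). For λ in a neighborhood of 1 (so that |λω| < 1), define g(λ) = S_{λω}(Φ_{λω}) − S_{λω}(Φ_ω), where Φ_μ = (φ_μ, iμφ_μ) with φ_μ the explicit ground state of frequency μ, and S_μ(u,v) = E(u,v) + μ·Q(u,v). Then g(λ) = o((λ−1)²) as λ → 1; that is, g(λ)/(λ−1)² → 0 as λ → 1 with λ ≠ 1. -/

import Mathlib

open MeasureTheory ComplexConjugate

/-- The explicit one-dimensional ground state of `-φ'' + (1-μ²)φ = φ^p`. -/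
noncomputable def groundState (p μ : ℝ) (x : ℝ) : ℝ :=
  ((p + 1) * (1 - μ ^ 2) / 2) ^ ((1 : ℝ) / (p - 1)) *
    Real.cosh ((p - 1) / 2 * Real.sqrt (1 - μ ^ 2) * x) ^ (-(2 : ℝ) / (p - 1))

/-- `∫ φ_ν²`. -/
noncomputable def Nphi (p ν : ℝ) : ℝ := ∫ x : ℝ, groundState p ν x ^ 2

/-- The energy of the standing wave pair `Φ_ν = (φ_ν, iνφ_ν)`. -/
noncomputable def energyPhi (p ν : ℝ) : ℝ :=
  (1 / 2) * (ν ^ 2 * Nphi p ν + (∫ x : ℝ, deriv (groundState p ν) x ^ 2) + Nphi p ν)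
    - (1 / (p + 1)) * ∫ x : ℝ, groundState p ν x ^ (p + 1)

/-- The charge of the standing wave pair, `Q(Φ_ν) = -ν ∫ φ_ν²`. -/
noncomputable def chargePhi (p ν : ℝ) : ℝ := -ν * Nphi p ν

/-- The action `S_μ(Φ_ν) = E(Φ_ν) + μ Q(Φ_ν)` evaluated at the standing wave pair `Φ_ν`. -/
noncomputable def actionPhi (p μ ν : ℝ) : ℝ := energyPhi p ν + μ * chargePhi p ν


lemma cosh_rpow_integrable {q : ℝ} (hq : 0 < q) :
    Integrable (fun x : ℝ => Real.cosh x ^ (-q)) := by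
  have hcont : Continuous (fun x : ℝ => Real.cosh x ^ (-q)) :=
    Real.continuous_cosh.rpow_const (fun x => Or.inl (Real.cosh_pos x).ne')
  have hO : IntegrableOn (fun x : ℝ => Real.cosh x ^ (-q)) (Set.Ioi 0) := by
    refine integrable_of_isBigO_exp_neg (b := q) hq hcont.continuousOn ?_
    refine Asymptotics.IsBigO.of_bound ((2:ℝ)⁻¹ ^ (-q)) (Filter.Eventually.of_forall fun x => ?_)
    rw [Real.norm_of_nonneg (Real.rpow_nonneg (Real.cosh_pos x).le _),
      Real.norm_of_nonneg (Real.exp_pos _).le]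
    have h1 : Real.exp (-q * x) = Real.exp x ^ (-q) := by
      rw [← Real.exp_mul]; ring_nf
    rw [h1, ← Real.mul_rpow (by norm_num) (Real.exp_pos _).le]
    apply Real.rpow_le_rpow_of_nonpos (by positivity) _ (by linarith)
    rw [Real.cosh_eq]
    have := Real.exp_pos (-x)
    linarith
  have hO2 : IntegrableOn (fun x : ℝ => Real.cosh x ^ (-q)) (Set.Iic 0) := by
    rw [integrableOn_Iic_iff_integrableOn_Iio]
    have h3 : IntegrableOn (fun x : ℝ => Real.cosh x ^ (-q)) (Set.Ioi (-0)) := by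
      rw [neg_zero]; exact hO
    have h4 := MeasureTheory.IntegrableOn.comp_neg_Iio (c := (0:ℝ)) h3
    simpa only [Real.cosh_neg] using h4
  rw [← integrableOn_univ, ← Set.Iic_union_Ioi (a := (0:ℝ))]
  exact hO2.union hO

lemma cosh_sq_split (q x : ℝ) :
    Real.sinh x ^ 2 * Real.cosh x ^ (-q - 2) = Real.cosh x ^ (-q) - Real.cosh x ^ (-q - 2) := by
  have h : Real.cosh x ^ (-q) = Real.cosh x ^ (-q - 2) * Real.cosh x ^ 2 := by
    rw [← Real.rpow_add_natCast (Real.cosh_pos x).ne']; norm_num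
  rw [h, Real.cosh_sq]; ring

lemma J_integrable {q : ℝ} (hq : 0 < q) :
    Integrable (fun x : ℝ => Real.sinh x ^ 2 * Real.cosh x ^ (-q - 2)) := by
  simp_rw [cosh_sq_split]
  have h := cosh_rpow_integrable (q := q + 2) (by linarith)
  rw [show -(q+2) = -q - 2 by ring] at h
  exact (cosh_rpow_integrable hq).sub h

lemma J_eq {q : ℝ} (hq : 0 < q) :
    ∫ x : ℝ, Real.sinh x ^ 2 * Real.cosh x ^ (-q - 2) =
      (∫ x : ℝ, Real.cosh x ^ (-q)) - ∫ x : ℝ, Real.cosh x ^ (-q - 2) := by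
  simp_rw [cosh_sq_split]
  have h := cosh_rpow_integrable (q := q + 2) (by linarith)
  rw [show -(q+2) = -q - 2 by ring] at h
  exact integral_sub (cosh_rpow_integrable hq) h

lemma J_eq2 {q : ℝ} (hq : 0 < q) :
    q * ∫ x : ℝ, Real.sinh x ^ 2 * Real.cosh x ^ (-q - 2) =
      ∫ x : ℝ, Real.cosh x ^ (-q - 2) := by
  have h := cosh_rpow_integrable (q := q + 2) (by linarith)
  rw [show -(q+2) = -q - 2 by ring] at h
  have hJ := J_integrable hq
  have hd : ∀ x : ℝ, HasDerivAt (fun x => Real.sinh x * Real.cosh x ^ (-q - 1))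
      (Real.cosh x ^ (-q - 2) - q * (Real.sinh x ^ 2 * Real.cosh x ^ (-q - 2))) x := by
    intro x
    have h1 := (Real.hasDerivAt_sinh x).mul
      ((Real.hasDerivAt_cosh x).rpow_const (p := -q - 1) (Or.inl (Real.cosh_pos x).ne'))
    refine h1.congr_deriv ?_
    have e1 : Real.cosh x ^ (-q - 1) = Real.cosh x ^ (-q - 2) * Real.cosh x := by
      rw [← Real.rpow_add_one (Real.cosh_pos x).ne']; ring_nf
    rw [show -q - 1 - 1 = -q - 2 by ring, e1]
    linear_combination Real.cosh x ^ (-q - 2) * Real.cosh_sq x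
  have hi : Integrable (fun x : ℝ => Real.sinh x * Real.cosh x ^ (-q - 1)) := by
    refine (cosh_rpow_integrable hq).mono' ?_ (Filter.Eventually.of_forall fun x => ?_)
    · exact (Real.continuous_sinh.mul (Real.continuous_cosh.rpow_const
        (fun x => Or.inl (Real.cosh_pos x).ne'))).aestronglyMeasurable
    · have e1 : Real.cosh x ^ (-q) = Real.cosh x * Real.cosh x ^ (-q - 1) := by
        rw [mul_comm, ← Real.rpow_add_one (Real.cosh_pos x).ne']; ring_nf
      rw [norm_mul, Real.norm_of_nonneg (Real.rpow_nonneg (Real.cosh_pos x).le (-q-1)), e1]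
      gcongr
      rw [Real.norm_eq_abs]
      apply abs_le_of_sq_le_sq _ (Real.cosh_pos x).le
      rw [Real.cosh_sq]; linarith
  have h0 := integral_eq_zero_of_hasDerivAt_of_integrable hd (h.sub (hJ.const_mul q)) hi
  rw [integral_sub h (hJ.const_mul q), integral_const_mul] at h0
  linarith

lemma int_scale {b : ℝ} (hb : 0 < b) (f : ℝ → ℝ) : ∫ x, f (b * x) = b⁻¹ * ∫ x, f x := by
  rw [Measure.integral_comp_mul_left, abs_of_pos (inv_pos.mpr hb), smul_eq_mul]

/-- Closed form of the action. -/
lemma action_closed (p r : ℝ) (hp : 1 < p) (hr : r = 2 / (p - 1)) :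
    ∃ M : ℝ, ∀ μ ν : ℝ, ν ^ 2 < 1 → actionPhi p μ ν =
      M * ((1 - ν ^ 2) ^ (r - 1 / 2) - (1 - ν ^ 2) ^ (r - 1 / 2 + 1) * (r / (r + 1 / 2))
        - μ * ν * (1 - ν ^ 2) ^ (r - 1 / 2)) := by
  have hp1 : 0 < p - 1 := by linarith
  have hr0 : 0 < r := by rw [hr]; positivity
  have hrp : r * (p - 1) = 2 := by rw [hr]; field_simp
  set I := ∫ x : ℝ, Real.cosh x ^ (-(2 * r)) with hI
  have hJ1 := J_eq (q := 2 * r) (by linarith)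
  have hJ2 := J_eq2 (q := 2 * r) (by linarith)
  set J := ∫ x : ℝ, Real.sinh x ^ 2 * Real.cosh x ^ (-(2 * r) - 2) with hJ
  set L := ∫ x : ℝ, Real.cosh x ^ (-(2 * r) - 2) with hL
  rw [← hI] at hJ1
  refine ⟨((p + 1) / 2) ^ r * r * I, fun μ ν hν => ?_⟩
  have ha : 0 < 1 - ν ^ 2 := by linarith
  set a := 1 - ν ^ 2 with haa
  set b := (p - 1) / 2 * Real.sqrt a with hb
  have hsq : 0 < Real.sqrt a := Real.sqrt_pos.mpr ha
  have hb0 : 0 < b := by positivity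
  have hrb : r * b = Real.sqrt a := by rw [hb]; linear_combination Real.sqrt a / 2 * hrp
  have hbinv : b⁻¹ = r * (Real.sqrt a)⁻¹ := by rw [← hrb]; field_simp
  set c := (p + 1) * a / 2 with hc
  have hc0 : 0 < c := by have : 0 < p + 1 := by linarith
                         positivity
  set K := c ^ ((1 : ℝ) / (p - 1)) with hK
  have hK0 : 0 < K := Real.rpow_pos_of_pos hc0 _
  have hg : groundState p ν = fun x => K * Real.cosh (b * x) ^ (-r) := by
    funext x
    simp only [groundState]
    rw [← haa, ← hb, ← hc, ← hK, hr, neg_div]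
  have hK2 : K ^ 2 = c ^ r := by
    rw [hK, ← Real.rpow_mul_natCast hc0.le, hr]; congr 1; push_cast; ring
  have hKp : K ^ (p + 1) = c ^ r * c := by
    rw [hK, ← Real.rpow_mul hc0.le, ← Real.rpow_add_one hc0.ne', hr]; congr 1; field_simp; ring
  have hcosh2 : ∀ y : ℝ, (Real.cosh y ^ (-r)) ^ 2 = Real.cosh y ^ (-(2 * r)) := by
    intro y
    rw [← Real.rpow_mul_natCast (Real.cosh_pos y).le]; congr 1; push_cast; ring
  have hN : Nphi p ν = c ^ r * (b⁻¹ * I) := by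
    rw [Nphi, hg]
    simp_rw [mul_pow, hcosh2, hK2]
    rw [integral_const_mul, int_scale hb0 (fun y => Real.cosh y ^ (-(2 * r)))]
  have hD : ∫ x : ℝ, deriv (groundState p ν) x ^ 2 = c ^ r * a * (b⁻¹ * J) := by
    have hder : ∀ x, deriv (groundState p ν) x ^ 2 =
        c ^ r * a * (Real.sinh (b * x) ^ 2 * Real.cosh (b * x) ^ (-(2 * r) - 2)) := by
      intro x
      have h1 : HasDerivAt (fun x => b * x) b x := by
        simpa using (hasDerivAt_id x).const_mul b
      have h2 := ((h1.cosh.rpow_const (p := -r)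
        (Or.inl (Real.cosh_pos (b * x)).ne')).const_mul K)
      rw [hg, h2.deriv]
      have e : (Real.cosh (b * x) ^ (-r - 1)) ^ 2 = Real.cosh (b * x) ^ (-(2 * r) - 2) := by
        rw [← Real.rpow_mul_natCast (Real.cosh_pos (b * x)).le]; congr 1; push_cast; ring
      rw [← e, ← hK2, ← Real.sq_sqrt ha.le, ← hrb]
      ring
    simp_rw [hder]
    rw [integral_const_mul,
      int_scale hb0 (fun y => Real.sinh y ^ 2 * Real.cosh y ^ (-(2 * r) - 2))]
  have hP : ∫ x : ℝ, groundState p ν x ^ (p + 1) = c ^ r * c * (b⁻¹ * L) := by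
    have hx : ∀ x, groundState p ν x ^ (p + 1) =
        c ^ r * c * Real.cosh (b * x) ^ (-(2 * r) - 2) := by
      intro x
      have hch := Real.cosh_pos (b * x)
      rw [hg]
      simp only []
      rw [Real.mul_rpow hK0.le (Real.rpow_nonneg hch.le _), hKp, ← Real.rpow_mul hch.le]
      congr 2
      linear_combination - hrp
    simp_rw [hx]
    rw [integral_const_mul, int_scale hb0 (fun y => Real.cosh y ^ (-(2 * r) - 2))]
  have hcr : c ^ r = ((p + 1) / 2) ^ r * a ^ r := by
    rw [← Real.mul_rpow (by linarith) ha.le, hc]; congr 1; ring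
  have has : a ^ (r - 1 / 2) = a ^ r * (Real.sqrt a)⁻¹ := by
    rw [Real.rpow_sub ha, ← Real.sqrt_eq_rpow]; rfl
  have has1 : a ^ (r - 1 / 2 + 1) = a ^ r * (Real.sqrt a)⁻¹ * a := by
    rw [Real.rpow_add_one ha.ne', has]
  have hJv : J = I / (2 * r + 1) := by
    rw [eq_div_iff (by positivity)]; linarith
  have hLv : L = 2 * r * I / (2 * r + 1) := by
    rw [← hJ2, hJv]; ring
  rw [actionPhi, energyPhi, chargePhi, hD, hP, hN, has1, has, hcr, hbinv, hJv, hLv, hc,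
    show ν ^ 2 = 1 - a by rw [haa]; ring]
  have hp2 : p + 1 ≠ 0 := by linarith
  have hr2 : 2 * r + 1 ≠ 0 := by positivity
  rw [show r + 1 / 2 = (2 * r + 1) / 2 by ring]
  field_simp
  ring

theorem stmt5 (p ω : ℝ) (hp : 1 < p) (hp5 : p < 5)
    (hω : ω = Real.sqrt (p - 1) / 2 ∨ ω = -(Real.sqrt (p - 1) / 2)) :
    Filter.Tendsto
      (fun lam : ℝ =>
        (actionPhi p (lam * ω) (lam * ω) - actionPhi p (lam * ω) ω) / (lam - 1) ^ 2)
      (nhdsWithin 1 {(1 : ℝ)}ᶜ) (nhds 0) := by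
  have hp1 : 0 < p - 1 := by linarith
  have hω2 : ω ^ 2 = (p - 1) / 4 := by
    have := Real.sq_sqrt hp1.le
    rcases hω with h | h <;> rw [h] <;> linear_combination this / 4
  obtain ⟨r, hr⟩ : ∃ r, r = 2 / (p - 1) := ⟨_, rfl⟩
  have hrω : 2 * r * ω ^ 2 = 1 := by rw [hr, hω2]; field_simp; norm_num
  have hr1 : 1 / 2 < r := by
    rw [hr, lt_div_iff₀ hp1]; linarith
  obtain ⟨M, hM⟩ := action_closed p r hp hr
  have hω1 : ω ^ 2 < 1 := by rw [hω2]; linarith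
  obtain ⟨s, hs⟩ : ∃ s, s = r - 1 / 2 := ⟨_, rfl⟩
  have hs0 : 0 < s := by linarith
  have hrs : r = s + 1 / 2 := by linarith
  rw [← hs] at hM
  have hcont : Continuous (fun l : ℝ => (l * ω) ^ 2) := by fun_prop
  have hev : ∀ᶠ l : ℝ in nhds 1, (l * ω) ^ 2 < 1 :=
    hcont.continuousAt.eventually_lt continuousAt_const (by simpa using hω1)
  set F : ℝ → ℝ := fun l => M * ((1 - (l * ω) ^ 2) ^ (s + 1) * (1 / (2 * (s + 1)))
    - ((1 - ω ^ 2) ^ s - (1 - ω ^ 2) ^ (s + 1) * (r / (s + 1)) - l * ω ^ 2 * (1 - ω ^ 2) ^ s)) with hF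
  set G : ℝ → ℝ := fun l => M * (ω ^ 2 * (1 - ω ^ 2) ^ s - l * ω ^ 2 * (1 - (l * ω) ^ 2) ^ s) with hG
  have hbase : ∀ l : ℝ, HasDerivAt (fun l : ℝ => 1 - (l * ω) ^ 2) (-(2 * l * ω ^ 2)) l := by
    intro l
    have := ((((hasDerivAt_id l).mul_const ω).pow 2).const_sub 1)
    refine this.congr_deriv ?_
    simp; ring
  have hFd : ∀ᶠ l : ℝ in nhds 1, HasDerivAt F (G l) l := by
    filter_upwards [hev] with l hl
    have h1 := ((hbase l).rpow_const (p := s + 1) (Or.inl (by linarith))).mul_const (1 / (2 * (s + 1)))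
    have h2 : HasDerivAt (fun l : ℝ => (1 - ω ^ 2) ^ s - (1 - ω ^ 2) ^ (s + 1) * (r / (s + 1))
        - l * ω ^ 2 * (1 - ω ^ 2) ^ s) (-(ω ^ 2 * (1 - ω ^ 2) ^ s)) l := by
      have := (((hasDerivAt_id l).mul_const (ω ^ 2)).mul_const ((1 - ω ^ 2) ^ s)).const_sub
        ((1 - ω ^ 2) ^ s - (1 - ω ^ 2) ^ (s + 1) * (r / (s + 1)))
      simpa using this
    refine ((h1.sub h2).const_mul M).congr_deriv ?_
    rw [add_sub_cancel_right]
    simp only [hG]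
    field_simp
    ring
  have ha : 0 < 1 - ω ^ 2 := by linarith
  have hGd : HasDerivAt G 0 1 := by
    have h1 := (hbase 1).rpow_const (p := s) (Or.inl (by simpa using ha.ne'))
    have h2 := (((((hasDerivAt_id (1:ℝ)).mul_const (ω ^ 2)).mul h1).const_sub
      (ω ^ 2 * (1 - ω ^ 2) ^ s)).const_mul M)
    refine h2.congr_deriv ?_
    have e : (1 - ω ^ 2) ^ s = (1 - ω ^ 2) ^ (s - 1) * (1 - ω ^ 2) := by
      rw [← Real.rpow_add_one ha.ne']; ring_nf
    simp only [id, one_mul, mul_one]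
    rw [e]
    rw [hrs] at hrω
    linear_combination (M * ω ^ 2 * (1 - ω ^ 2) ^ (s - 1)) * hrω
  have hG1 : G 1 = 0 := by simp [hG]
  have hF1 : F 1 = 0 := by
    simp only [hF, one_mul]
    rw [Real.rpow_add_one ha.ne', hrs]
    field_simp
    ring
  have hcongr : (fun l : ℝ => F l / (l - 1) ^ 2) =ᶠ[nhdsWithin 1 {(1 : ℝ)}ᶜ] (fun lam : ℝ =>
        (actionPhi p (lam * ω) (lam * ω) - actionPhi p (lam * ω) ω) / (lam - 1) ^ 2) := by
    filter_upwards [hev.filter_mono nhdsWithin_le_nhds] with l hl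
    have hl0 : 0 < 1 - (l * ω) ^ 2 := by linarith
    rw [hM _ _ hl, hM _ _ hω1]
    simp only [hF]
    rw [Real.rpow_add_one hl0.ne', hrs, show s + 1 / 2 + 1 / 2 = s + 1 by ring]
    congr 1
    field_simp
    ring
  refine Filter.Tendsto.congr' hcongr ?_
  refine HasDerivAt.lhopital_zero_nhdsNE (f' := G) (g' := fun l => 2 * (l - 1))
    (hFd.filter_mono nhdsWithin_le_nhds) (Filter.Eventually.of_forall fun l => ?_) ?_ ?_ ?_ ?_
  · have := ((hasDerivAt_id l).sub_const 1).pow 2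
    refine this.congr_deriv ?_
    simp
  · filter_upwards [self_mem_nhdsWithin] with l hl
    have : l - 1 ≠ 0 := sub_ne_zero.mpr hl
    positivity
  · have := hFd.self_of_nhds.continuousAt.tendsto
    rw [hF1] at this
    exact this.mono_left nhdsWithin_le_nhds
  · have : Continuous (fun l : ℝ => (l - 1) ^ 2) := by fun_prop
    have := this.tendsto 1
    simp only [sub_self, ne_eq, OfNat.ofNat_ne_zero, not_false_eq_true, zero_pow] at this
    exact this.mono_left nhdsWithin_le_nhds
  · have := (hasDerivAt_iff_tendsto_slope.mp hGd).const_mul (1 / 2)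
    rw [mul_zero] at this
    refine this.congr fun l => ?_
    rw [slope_def_field, hG1, sub_zero, div_mul_div_comm, one_mul]
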